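/- (Noisy pairs dominate the supervised non-contrastive loss.) Let q be a nonzero vector in a finite-dimensional real inner product space with q̃ = q/‖q‖, and let k_j, k_m be unit vectors (a clean pair and a noisy pair respectively) satisfying ⟨q̃, k_m⟩² < ⟨q̃, k_j⟩². Writing L_r(q; k) = 2(1 − ⟨q̃, k⟩), the gradient with respect to q of the noisy-pair loss is strictly larger in norm than that of the clean-pair loss: ‖∇_q L_r(q; k_m)‖² = (4/‖q‖²)(1 − ⟨q̃, k_m⟩²) > (4/‖q‖²)(1 − ⟨q̃, k_j⟩²) = ‖∇_q L_r(q; k_j)‖². -/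

import Mathlib

open scoped RealInnerProductSpace

/-- The norm of a real inner product space has gradient `‖q‖⁻¹ • q` away from the origin. -/
theorem hasFDerivAt_norm_of_ne_zero {E : Type*} [NormedAddCommGroup E] [InnerProductSpace ℝ E]
    {q : E} (hq : q ≠ 0) :
    HasFDerivAt (fun p : E => ‖p‖) (‖q‖⁻¹ • innerSL ℝ q) q := by
  have h := (hasStrictFDerivAt_norm_sq q).hasFDerivAt.sqrt (pow_ne_zero 2 (norm_ne_zero_iff.2 hq))
  simp only [Real.sqrt_sq (norm_nonneg _)] at h
  refine h.congr_fderiv ?_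
  ext v
  have := norm_ne_zero_iff.2 hq
  simp
  field_simp

/-- The gradient of the loss `p ↦ 2 (1 - ⟪p / ‖p‖, k⟫)` is `-2 / ‖q‖` times the component of `k`
orthogonal to `q`. -/
theorem hasGradientAt_normalized_inner_loss {E : Type*} [NormedAddCommGroup E]
    [InnerProductSpace ℝ E] [CompleteSpace E] {q : E} (hq : q ≠ 0) (k : E) :
    HasGradientAt (fun p : E => 2 * (1 - ⟪‖p‖⁻¹ • p, k⟫))
      ((-2 / ‖q‖) • (k - ⟪‖q‖⁻¹ • q, k⟫ • (‖q‖⁻¹ • q))) q := by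
  have hn : ‖q‖ ≠ 0 := norm_ne_zero_iff.2 hq
  rw [hasGradientAt_iff_hasFDerivAt]
  have hinv := (hasDerivAt_inv hn).comp_hasFDerivAt q (hasFDerivAt_norm_of_ne_zero hq)
  have h := (((hinv.smul (hasFDerivAt_id q)).inner ℝ
    (hasFDerivAt_const k q)).const_sub 1).const_mul 2
  refine h.congr_fderiv ?_
  ext v
  simp [inner_add_left, real_inner_smul_right, real_inner_comm]
  field_simp
  ring

theorem norm_sq_gradient_normalized_inner_loss {E : Type*} [NormedAddCommGroup E]
    [InnerProductSpace ℝ E] [CompleteSpace E] {q k : E} (hq : q ≠ 0) (hk : ‖k‖ = 1) :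
    ‖gradient (fun p : E => 2 * (1 - ⟪‖p‖⁻¹ • p, k⟫)) q‖ ^ 2
      = 4 / ‖q‖ ^ 2 * (1 - ⟪‖q‖⁻¹ • q, k⟫ ^ 2) := by
  have hu : ‖‖q‖⁻¹ • q‖ = 1 := norm_smul_inv_norm hq
  rw [(hasGradientAt_normalized_inner_loss hq k).gradient, norm_smul, mul_pow,
    norm_sub_sq_real, real_inner_smul_right, norm_smul, hu, hk, real_inner_comm k,
    Real.norm_eq_abs, Real.norm_eq_abs, mul_one, sq_abs, sq_abs]
  ring

/-- Noisy pairs dominate the supervised non-contrastive loss: if `k_j` (clean) and `k_m`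
(noisy) are unit vectors with `⟨q̃, k_m⟩² < ⟨q̃, k_j⟩²`, then for
`L_r(q; k) = 2(1 − ⟨q̃, k⟩)` one has
`‖∇_q L_r(q; k_m)‖² = (4/‖q‖²)(1 − ⟨q̃, k_m⟩²) > (4/‖q‖²)(1 − ⟨q̃, k_j⟩²) = ‖∇_q L_r(q; k_j)‖²`. -/
theorem stmt4 {E : Type*} [NormedAddCommGroup E] [InnerProductSpace ℝ E]
    [FiniteDimensional ℝ E] (q kj km : E) (hq : q ≠ 0)
    (hkj : ‖kj‖ = 1) (hkm : ‖km‖ = 1)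
    (h : ⟪‖q‖⁻¹ • q, km⟫ ^ 2 < ⟪‖q‖⁻¹ • q, kj⟫ ^ 2) :
    ‖gradient (fun p : E => 2 * (1 - ⟪‖p‖⁻¹ • p, km⟫)) q‖ ^ 2
        = 4 / ‖q‖ ^ 2 * (1 - ⟪‖q‖⁻¹ • q, km⟫ ^ 2) ∧
      4 / ‖q‖ ^ 2 * (1 - ⟪‖q‖⁻¹ • q, km⟫ ^ 2)
        > 4 / ‖q‖ ^ 2 * (1 - ⟪‖q‖⁻¹ • q, kj⟫ ^ 2) ∧
      4 / ‖q‖ ^ 2 * (1 - ⟪‖q‖⁻¹ • q, kj⟫ ^ 2)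
        = ‖gradient (fun p : E => 2 * (1 - ⟪‖p‖⁻¹ • p, kj⟫)) q‖ ^ 2 := by
  refine ⟨norm_sq_gradient_normalized_inner_loss hq hkm, ?_,
    (norm_sq_gradient_normalized_inner_loss hq hkj).symm⟩
  have : 0 < ‖q‖ := norm_pos_iff.2 hq
  gcongr
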